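/- Let d ≥ 1 and s ≥ 2 be integers. There is a constant C > 0 depending only on d and s such that the following holds. Let q be an odd prime power whose characteristic does not divide s, let P(x) = ∑_{j=1}^d a_j x_j^s with all a_j ∈ F_q∖{0}, let E ⊆ F_q^d, X ⊆ F_q, and let k ≥ 2 be an even integer. Then ∑_{t∈F_q} ν_{P,k}(t)² ≤ |X|²·|E|^{2k}/q + C·q^d·|X|·Λ_k(E)². -/

import Mathlib

open Finset

/-- The `k`-energy `Λ_k(E)` of a set `E` (intended for even `k = 2m`): the number of
`k`-tuples from `E` whose first `k/2` entries and last `k/2` entries have equal sums. -/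
noncomputable def energy {G : Type} [AddCommMonoid G] (E : Finset G) (k : ℕ) : ℕ :=
  Nat.card {x : Fin k → G // (∀ i, x i ∈ E) ∧
    (∑ i ∈ Finset.univ.filter (fun i : Fin k => (i : ℕ) < k / 2), x i) =
    (∑ i ∈ Finset.univ.filter (fun i : Fin k => ¬ (i : ℕ) < k / 2), x i)}

/-- `ν_{P,k}(t)` for the diagonal polynomial `P(x) = ∑_j a j * x_j ^ s`: the number of tuples
`(b, x¹, …, x^k) ∈ X × E^k` with `b + P(x¹ + ⋯ + x^k) = t`. -/
noncomputable def nuP {F : Type} [Field F] [Fintype F] {d : ℕ} (a : Fin d → F) (s : ℕ)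
    (E : Finset (Fin d → F)) (X : Finset F) (k : ℕ) (t : F) : ℕ :=
  Nat.card {p : F × (Fin k → (Fin d → F)) // p.1 ∈ X ∧ (∀ i, p.2 i ∈ E) ∧
    p.1 + ∑ j, a j * ((∑ i, p.2 i) j) ^ s = t}

open Polynomial in
theorem natDegree_sum_pow_pow {L : Type*} [Field L] (f : L[X]) {q : ℕ} (hq : 1 < q)
    (hf : 0 < f.natDegree) (m : ℕ) :
    (∑ i ∈ range (m + 1), f ^ q ^ i).natDegree = f.natDegree * q ^ m := by
  induction m with
  | zero => simp
  | succ m ih =>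
    rw [sum_range_succ, natDegree_add_eq_right_of_natDegree_lt, natDegree_pow, mul_comm]
    rw [ih, natDegree_pow, mul_comm]
    exact Nat.mul_lt_mul_of_pos_right (Nat.pow_lt_pow_right hq (Nat.lt_succ_self m)) hf

theorem frobenius_pow_apply (F : Type*) [Field F] [Fintype F] {L : Type*} [Field L] [Algebra F L]
    (n : ℕ) (x : L) :
    (FiniteField.frobeniusAlgHom F L ^ n) x = x ^ Fintype.card F ^ n := by
  rw [AlgHom.coe_pow, FiniteField.coe_frobeniusAlgHom, pow_iterate]

open Polynomial in
/-- Polynomials with pairwise distinct degrees are linearly independent. -/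
theorem sum_C_mul_ne_zero {L ι : Type*} [Field L] [Fintype ι] (g : ι → L[X])
    (hg : ∀ i, g i ≠ 0) (hinj : Function.Injective fun i => (g i).natDegree) (c : ι → L)
    (hc : c ≠ 0) : ∑ i, C (c i) * g i ≠ 0 := by
  obtain ⟨i, hi⟩ := Function.ne_iff.1 hc
  intro h
  have hdeg := degree_sum_eq_of_disjoint (fun i => C (c i) * g i) univ (by
    intro j hj k hk hjk h
    have hcj : c j ≠ 0 := fun h0 => hj.2 (by simp [h0])
    have hck : c k ≠ 0 := fun h0 => hk.2 (by simp [h0])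
    apply hjk
    apply hinj
    have := natDegree_eq_of_degree_eq h
    simpa [natDegree_C_mul hcj, natDegree_C_mul hck] using this)
  rw [h, degree_zero, eq_comm, Finset.sup_eq_bot_iff] at hdeg
  have := hdeg i (mem_univ i)
  rw [degree_eq_bot] at this
  exact mul_ne_zero (C_ne_zero.2 hi) (hg i) this

open Polynomial in
theorem exists_sum_C_mul_eq_zero {L ι : Type*} [Field L] [Fintype ι] (g : ι → L[X]) (D : ℕ)
    (hg : ∀ i, (g i).natDegree < D) (hD : D < Fintype.card ι) :
    ∃ c : ι → L, c ≠ 0 ∧ ∑ i, C (c i) * g i = 0 := by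
  have hmem (i) : g i ∈ degreeLT L D := by
    rw [mem_degreeLT]
    exact (degree_le_natDegree).trans_lt (by exact_mod_cast hg i)
  have hfin : Module.finrank L (degreeLT L D) = D := by
    rw [(degreeLTEquiv L D).finrank_eq]; simp
  have : FiniteDimensional L (degreeLT L D) :=
    (degreeLTEquiv L D).symm.finiteDimensional
  have hdep : ¬ LinearIndependent L (fun i => (⟨g i, hmem i⟩ : degreeLT L D)) := by
    intro h
    have := h.fintype_card_le_finrank
    omega
  rw [Fintype.not_linearIndependent_iff] at hdep
  obtain ⟨c, hc, i, hi⟩ := hdep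
  refine ⟨c, fun h => hi (by simp [h]), ?_⟩
  have := congrArg Subtype.val hc
  simpa [smul_eq_C_mul] using this

open Polynomial in
/-- Stepanov's bound for the number of `x` in the extension of degree `2 (m + 1)` of `F` at which
the trace of `f x` takes a given value. -/
theorem card_le_of_trace_eq {F : Type*} [Field F] [Fintype F] {L : Type*} [Field L] [IsAlgClosed L]
    [Algebra F L] (f : L[X]) (hcop : Nat.Coprime f.natDegree (Fintype.card F)) (m : ℕ)
    (hm : f.natDegree + 2 ≤ Fintype.card F ^ (m + 1)) (z : L) (Z : Finset L)
    (hfix : ∀ x ∈ Z, x ^ Fintype.card F ^ (2 * (m + 1)) = x)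
    (htr : ∀ x ∈ Z, ∑ i ∈ range (2 * (m + 1)), (f.eval x) ^ Fintype.card F ^ i = z) :
    Z.card ≤ Fintype.card F ^ (2 * m + 1) +
      (2 * f.natDegree + 3) * Fintype.card F ^ (m + 1) := by
  have hφ := frobenius_pow_apply F (L := L) (m + 1)
  have hq : 1 < Fintype.card F := Fintype.one_lt_card
  generalize Fintype.card F = q at *
  set s := f.natDegree with hs
  have hs0 : 0 < s := by
    rcases Nat.eq_zero_or_pos s with h | h
    · rw [h] at hcop; simp at hcop; omega
    · exact h
  set A : L[X] := ∑ i ∈ range (m + 1), f ^ q ^ i with hA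
  have hAdeg : A.natDegree = s * q ^ m := natDegree_sum_pow_pow f hq hs0 m
  have hP'0 : 0 < q ^ m := by positivity
  have hA0 : A ≠ 0 := fun h => by
    rw [h, natDegree_zero] at hAdeg
    have : 0 < s * q ^ m := by positivity
    omega
  have hAZ : ∀ x ∈ Z, (A.eval x) ^ q ^ (m + 1) = z - A.eval x := by
    intro x hx
    have h1 := htr x hx
    rw [two_mul, sum_range_add] at h1
    rw [← h1, ← hφ, hA, eval_finsetSum, map_sum]
    simp only [eval_pow, hφ, add_sub_cancel_left]
    refine sum_congr rfl fun i _ => ?_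
    rw [← pow_mul, ← pow_add, add_comm]
  have hQ : q ^ (2 * (m + 1)) = q ^ (m + 1) * q ^ (m + 1) := by ring
  have hPP : q ^ (m + 1) = q ^ m * q := pow_succ _ _
  have hPP2 : q ^ (2 * m + 1) = q ^ m * q ^ (m + 1) := by ring
  rw [hPP2]
  rw [hQ] at hfix
  set P' := q ^ m with hP'
  set P := q ^ (m + 1) with hP
  have hP0 : 0 < P := by rw [hPP]; positivity
  let ι := Fin P' × Fin q × Fin (P' + s + 2)
  have hbound (t : ι) : t.2.1.1 * (s * P') + s * P' ≤ s * P := by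
    have := t.2.1.2
    rw [hPP]
    calc _ = s * (P' * (t.2.1.1 + 1)) := by ring
      _ ≤ _ := by gcongr; omega
  obtain ⟨b, hb0, hb⟩ := exists_sum_C_mul_eq_zero
    (fun t : ι => X ^ (t.1.1 * P + t.2.2.1) * (C z - A) ^ t.2.1.1)
    (P' * P + s * P + P' + s + 2) (by
      intro t
      refine natDegree_mul_le.trans_lt ?_
      have h1 : ((C z - A) ^ t.2.1.1).natDegree ≤ t.2.1.1 * (s * P') := by
        rw [natDegree_pow]
        gcongr
        refine (natDegree_sub_le _ _).trans ?_
        simp [hAdeg]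
      rw [natDegree_X_pow]
      have h2 := hbound t
      have h3 : t.1.1 * P ≤ P' * P := by gcongr; exact t.1.2.le
      have h4 := t.2.2.2
      omega)
    (by
      simp only [ι, Fintype.card_prod, Fintype.card_fin]
      have : P' * (q * (P' + s + 2)) = P' * P + s * P + 2 * P := by rw [hPP]; ring
      have : P' * 2 ≤ P := by rw [hPP]; gcongr; omega
      omega)
  choose c hc using fun t => IsAlgClosed.exists_pow_nat_eq (b t) hP0
  let g : ι → L[X] := fun t => X ^ (t.1.1 + P * t.2.2.1) * A ^ t.2.1.1
  have hgdeg (t : ι) : (g t).natDegree = t.1.1 + P * t.2.2.1 + t.2.1.1 * (s * P') := by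
    rw [natDegree_mul (by simp) (pow_ne_zero _ hA0), natDegree_X_pow, natDegree_pow, hAdeg]
  have hr0 : ∑ t, C (c t) * g t ≠ 0 := by
    apply sum_C_mul_ne_zero
    · intro t
      exact mul_ne_zero (by simp) (pow_ne_zero _ hA0)
    · intro t u h
      simp only [hgdeg] at h
      obtain ⟨⟨i, hi⟩, ⟨j, hj⟩, ⟨a, ha⟩⟩ := t
      obtain ⟨⟨i', hi'⟩, ⟨j', hj'⟩, ⟨a', ha'⟩⟩ := u
      simp only at h
      rw [hPP] at h
      have h' : i + P' * (q * a + j * s) = i' + P' * (q * a' + j' * s) := by linarith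
      have e1 : i = i' := by
        have := congrArg (· % P') h'
        simpa [Nat.add_mul_mod_self_left, Nat.mod_eq_of_lt, hi, hi'] using this
      subst e1
      have e2 : q * a + j * s = q * a' + j' * s :=
        Nat.eq_of_mul_eq_mul_left hP'0 (Nat.add_left_cancel h')
      have e3 : j = j' := by
        have h3 : j * s ≡ j' * s [MOD q] := by
          have := congrArg (· % q) e2
          simpa [Nat.ModEq, Nat.mul_add_mod] using this
        have h4 := Nat.ModEq.cancel_right_of_coprime hcop.symm h3
        exact Nat.ModEq.eq_of_lt_of_lt h4 hj hj'
      subst e3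
      have e4 : a = a' := Nat.eq_of_mul_eq_mul_left (by omega) (Nat.add_right_cancel e2)
      subst e4
      rfl
    · intro h
      apply hb0
      funext t
      rw [← hc t, h]
      simp [hP0.ne']
  have hroot : ∀ x ∈ Z, (∑ t, C (c t) * g t).eval x = 0 := by
    intro x hx
    have h0 := congrArg (eval x) hb
    refine (pow_eq_zero_iff hP0.ne').1 ?_
    rw [← hφ, eval_finsetSum, map_sum]
    rw [eval_finsetSum, eval_zero] at h0
    rw [← h0]
    refine sum_congr rfl fun t _ => ?_
    simp only [eval_mul, eval_C, g, eval_pow, eval_X, eval_sub, hφ, mul_pow, hc]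
    congr 2
    · rw [← pow_mul, add_mul, pow_add, pow_add]
      congr 1
      rw [show P * t.2.2.1 * P = (P * P) * t.2.2.1 by ring, pow_mul, hfix x hx]
    · rw [pow_right_comm, hAZ x hx]
  have hcard : Z.card ≤ (∑ t, C (c t) * g t).natDegree := by
    have hsub : Z.val ⊆ (∑ t, C (c t) * g t).roots := by
      intro x hx
      exact (mem_roots hr0).2 (hroot x hx)
    exact (Multiset.card_le_card ((Multiset.le_iff_subset Z.nodup).2 hsub)).trans (card_roots' _)
  refine hcard.trans (natDegree_sum_le_of_forall_le _ _ fun t _ => ?_)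
  refine (natDegree_C_mul_le _ _).trans ?_
  rw [hgdeg]
  have h1 := t.1.2
  have h2 := hbound t
  have h3 : P * t.2.2.1 ≤ P * (P' + s + 2) := by gcongr; exact t.2.2.2.le
  have h4 : P' ≤ P := by rw [hPP]; exact Nat.le_mul_of_pos_right _ (by omega)
  nlinarith

open PowerSeries in
/-- The power series `-X` times the logarithmic derivative of `G`; for `G = ∏ (1 - r X)` its
coefficients are the power sums of the `r`. -/
noncomputable def negLogDeriv {K : Type*} [Field K] (G : K⟦X⟧) : K⟦X⟧ :=
  -(X * d⁄dX K G * G⁻¹)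

section
open PowerSeries

theorem eq_negLogDeriv_iff {K : Type*} [Field K] {G S : K⟦X⟧} (hG : constantCoeff G ≠ 0) :
    S = negLogDeriv G ↔ S * G = -(X * d⁄dX K G) := by
  rw [negLogDeriv, ← neg_mul, PowerSeries.eq_mul_inv_iff_mul_eq hG]

theorem negLogDeriv_mul_self {K : Type*} [Field K] {G : K⟦X⟧} (hG : constantCoeff G ≠ 0) :
    negLogDeriv G * G = -(X * d⁄dX K G) :=
  (eq_negLogDeriv_iff hG).1 rfl

theorem negLogDeriv_mul {K : Type*} [Field K] {G H : K⟦X⟧} (hG : constantCoeff G ≠ 0)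
    (hH : constantCoeff H ≠ 0) : negLogDeriv (G * H) = negLogDeriv G + negLogDeriv H := by
  symm
  rw [eq_negLogDeriv_iff (by simp [hG, hH])]
  have h1 := negLogDeriv_mul_self hG
  have h2 := negLogDeriv_mul_self hH
  rw [Derivation.leibniz, smul_eq_mul, smul_eq_mul]
  linear_combination H * h1 + G * h2

theorem negLogDeriv_prod {K ι : Type*} [Field K] (s : Finset ι) (G : ι → K⟦X⟧)
    (hG : ∀ i, constantCoeff (G i) ≠ 0) :
    negLogDeriv (∏ i ∈ s, G i) = ∑ i ∈ s, negLogDeriv (G i) := by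
  classical
  induction s using Finset.induction_on with
  | empty => simp [negLogDeriv]
  | insert a s ha ih =>
    rw [prod_insert ha, sum_insert ha, negLogDeriv_mul (hG a) (by
      rw [map_prod]; exact prod_ne_zero_iff.2 fun i _ => hG i), ih]

theorem coeff_negLogDeriv_one_sub {K : Type*} [Field K] (r : K) {j : ℕ} (hj : j ≠ 0) :
    coeff j (negLogDeriv (1 - C r * X)) = r ^ j := by
  have : mk (fun j => if j = 0 then 0 else r ^ j) = negLogDeriv (1 - C r * X) := by
    rw [eq_negLogDeriv_iff (by simp)]
    ext n
    rw [mul_sub, mul_one, mul_left_comm]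
    rcases n with _ | n
    · simp
    · rw [map_sub, coeff_C_mul, coeff_succ_mul_X]
      rcases n with _ | n
      · simp [coeff_X]
      · simp [coeff_X, pow_succ, mul_comm]
  rw [← this, coeff_mk, if_neg hj]

theorem map_negLogDeriv {K L : Type*} [Field K] [Field L] (φ : K →+* L) {G : K⟦X⟧}
    (hG : constantCoeff G ≠ 0) : (negLogDeriv G).map φ = negLogDeriv (G.map φ) := by
  have hG' : constantCoeff (G.map φ) ≠ 0 := by
    rw [← coeff_zero_eq_constantCoeff_apply, coeff_map, coeff_zero_eq_constantCoeff_apply]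
    exact (map_ne_zero φ).2 hG
  rw [eq_negLogDeriv_iff hG', ← map_mul, negLogDeriv_mul_self hG]
  rw [map_neg, map_mul, PowerSeries.map_X]
  congr 2
  ext n
  simp [coeff_derivative]

theorem coeff_negLogDeriv_add_X_pow {K : Type*} [Field K] {G : K⟦X⟧} (hG : constantCoeff G = 1)
    (u : K) {s : ℕ} (hs : s ≠ 0) {j : ℕ} (hj : j ≤ s) :
    coeff j (negLogDeriv (G + C u * X ^ s)) =
      coeff j (negLogDeriv G) - if j = s then s * u else 0 := by
  have hG0 : constantCoeff G ≠ 0 := by simp [hG]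
  have hG2 : constantCoeff (G + C u * X ^ s) ≠ 0 := by simp [hG, hs]
  have h1 := negLogDeriv_mul_self hG0
  have h2 := negLogDeriv_mul_self hG2
  have hinv : G * G⁻¹ = 1 := PowerSeries.mul_inv_cancel _ hG0
  have hX : X * d⁄dX K (C u * X ^ s) = X ^ s * (C (s * u) : K⟦X⟧) := by
    obtain ⟨n, rfl⟩ := Nat.exists_eq_succ_of_ne_zero hs
    rw [Derivation.leibniz, derivative_pow]
    simp [pow_succ]
    ring
  have h3 : negLogDeriv (G + C u * X ^ s) = negLogDeriv G -
      X ^ s * ((C (s * u) + C u * negLogDeriv (G + C u * X ^ s)) * G⁻¹) := by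
    rw [map_add, mul_add X, hX] at h2
    linear_combination G⁻¹ * h2 - G⁻¹ * h1 -
      (negLogDeriv (G + C u * X ^ s) - negLogDeriv G) * hinv
  rw [h3, map_sub, coeff_X_pow_mul']
  rcases hj.lt_or_eq with h | rfl
  · simp [h.ne, h.not_ge]
  · simp [hG, negLogDeriv]
end

open Polynomial in
/-- The `j`-th power sum of the roots of the monic polynomial `g`. -/
noncomputable def rootPowerSum {K : Type*} [Field K] (g : K[X]) (j : ℕ) : K :=
  PowerSeries.coeff j (negLogDeriv (g.reverse : PowerSeries K))

section
open Polynomial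

theorem constantCoeff_reverse {K : Type*} [Field K] {g : K[X]} (hg : g.Monic) :
    PowerSeries.constantCoeff (g.reverse : PowerSeries K) = 1 := by
  rw [← PowerSeries.coeff_zero_eq_constantCoeff_apply, Polynomial.coeff_coe, coeff_zero_reverse]
  exact hg

theorem rootPowerSum_mul {K : Type*} [Field K] {g h : K[X]} (hg : g.Monic) (hh : h.Monic) (j : ℕ) :
    rootPowerSum (g * h) j = rootPowerSum g j + rootPowerSum h j := by
  rw [rootPowerSum, reverse_mul_of_domain, Polynomial.coe_mul, negLogDeriv_mul
    (by simp [constantCoeff_reverse hg]) (by simp [constantCoeff_reverse hh]), map_add]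
  rfl

theorem reverse_X_sub_C {K : Type*} [Field K] (r : K) : (X - C r).reverse = 1 - C r * X := by
  have : (X - C r : K[X]) = X + C (-r) := by simp [sub_eq_add_neg]
  rw [this, reverse, natDegree_X_add_C, reflect_add, reflect_one_X, reflect_C]
  simp [sub_eq_add_neg]

theorem reverse_prod_X_sub_C {K ι : Type*} [Field K] (s : Finset ι) (r : ι → K) :
    (∏ i ∈ s, (X - C (r i))).reverse = ∏ i ∈ s, (1 - C (r i) * X) := by
  classical
  induction s using Finset.induction_on with
  | empty => simpa using reverse_C (1 : K)
  | insert a s ha ih =>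
    rw [prod_insert ha, prod_insert ha, reverse_mul_of_domain, ih, reverse_X_sub_C]

theorem coeff_negLogDeriv_prod {K ι : Type*} [Field K] (s : Finset ι) (r : ι → K) {j : ℕ}
    (hj : j ≠ 0) :
    PowerSeries.coeff j (negLogDeriv ((∏ i ∈ s, (1 - C (r i) * X) : K[X]) : PowerSeries K)) =
      ∑ i ∈ s, r i ^ j := by
  have : ((∏ i ∈ s, (1 - C (r i) * X) : K[X]) : PowerSeries K) =
      ∏ i ∈ s, (1 - PowerSeries.C (r i) * PowerSeries.X) := by
    rw [← Polynomial.coeToPowerSeries.ringHom_apply, map_prod]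
    simp
  rw [this, negLogDeriv_prod _ _ (by simp), map_sum]
  exact sum_congr rfl fun i _ => coeff_negLogDeriv_one_sub _ hj

theorem rootPowerSum_prod {K ι : Type*} [Field K] (s : Finset ι) (r : ι → K) {j : ℕ}
    (hj : j ≠ 0) : rootPowerSum (∏ i ∈ s, (X - C (r i))) j = ∑ i ∈ s, r i ^ j := by
  rw [rootPowerSum, reverse_prod_X_sub_C, coeff_negLogDeriv_prod _ _ hj]

theorem rootPowerSum_X_sub_C {K : Type*} [Field K] (r : K) {j : ℕ} (hj : j ≠ 0) :
    rootPowerSum (X - C r) j = r ^ j := by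
  simpa using rootPowerSum_prod {()} (fun _ => r) hj

theorem rootPowerSum_map {K L : Type*} [Field K] [Field L] (φ : K →+* L) {g : K[X]}
    (hg : g.Monic) (j : ℕ) : rootPowerSum (g.map φ) j = φ (rootPowerSum g j) := by
  rw [rootPowerSum, rootPowerSum, ← PowerSeries.coeff_map, map_negLogDeriv _
    (by simp [constantCoeff_reverse hg])]
  congr 2
  rw [reverse, natDegree_map, reflect_map, ← reverse, Polynomial.polynomial_map_coe]

theorem rootPowerSum_add_X_pow {K : Type*} [Field K] {g : K[X]} (hg : g.Monic) (u : K) {s : ℕ}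
    (hs : s ≠ 0) (hsg : s ≤ g.natDegree) {j : ℕ} (hj : j ≤ s) :
    rootPowerSum (g + C u * X ^ (g.natDegree - s)) j =
      rootPowerSum g j - if j = s then s * u else 0 := by
  have hdeg : (g + C u * X ^ (g.natDegree - s)).natDegree = g.natDegree := by
    apply natDegree_add_eq_left_of_natDegree_lt
    exact (natDegree_C_mul_X_pow_le _ _).trans_lt (by omega)
  rw [rootPowerSum, reverse, hdeg, reflect_add, ← reverse, reflect_C_mul_X_pow,
    revAt_le (by omega), Nat.sub_sub_self hsg]
  simpa [rootPowerSum] using coeff_negLogDeriv_add_X_pow (constantCoeff_reverse hg) u hs hj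
end

open Filter Topology in
theorem norm_le_one_of_power_sums_bounded {ι : Type*} [Fintype ι] (z : ι → ℂ) (B : ℝ) (N : ℕ)
    (h : ∀ m, N ≤ m → ‖∑ i, z i ^ m‖ ≤ B) (i : ι) : ‖z i‖ ≤ 1 := by
  by_contra! hi
  have hex (j : ι) : ∃ u : Circle, z j = ‖z j‖ * (u : ℂ) := by
    by_cases hj : z j = 0
    · exact ⟨1, by simp [hj]⟩
    · have hn : (‖z j‖ : ℂ) ≠ 0 := by simpa using hj
      refine ⟨⟨z j / ‖z j‖, ?_⟩, ?_⟩
      · exact mem_sphere_zero_iff_norm.2 (by simp [hj])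
      · simp; field_simp
  choose u hu using hex
  have hcl := mapClusterPt_one_atTop_pow (G := ι → Circle) u
  have hU : {w : ι → Circle | ∀ j, (1 / 2 : ℝ) < (w j : ℂ).re} ∈ 𝓝 (1 : ι → Circle) := by
    have : IsOpen {w : ι → Circle | ∀ j, (1 / 2 : ℝ) < (w j : ℂ).re} := by
      simp only [Set.ofPred_forall]
      refine isOpen_iInter_of_finite fun j => isOpen_lt continuous_const ?_
      exact Complex.continuous_re.comp (continuous_subtype_val.comp (continuous_apply j))
    refine this.mem_nhds ?_
    intro j
    norm_num
  have hfreq := (mapClusterPt_iff_frequently.1 hcl) _ hU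
  have hev : ∀ᶠ m in atTop, N ≤ m ∧ 2 * B < ‖z i‖ ^ m :=
    (eventually_ge_atTop N).and ((tendsto_pow_atTop_atTop_of_one_lt hi).eventually_gt_atTop _)
  obtain ⟨m, hm, hNm, hBm⟩ := (hfreq.and_eventually hev).exists
  have hre (j : ι) : ‖z j‖ ^ m * (1 / 2) ≤ (z j ^ m).re := by
    have h1 : z j ^ m = ((‖z j‖ ^ m : ℝ) : ℂ) * ((u ^ m) j : ℂ) := by
      conv_lhs => rw [hu j, mul_pow]
      simp
    rw [h1, Complex.re_ofReal_mul]
    exact mul_le_mul_of_nonneg_left (hm j).le (by positivity)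
  have h2 : ‖z i‖ ^ m * (1 / 2) ≤ (∑ j, z j ^ m).re := by
    rw [Complex.re_sum]
    exact (hre i).trans (single_le_sum (f := fun j => (z j ^ m).re)
      (fun j _ => (by positivity : (0 : ℝ) ≤ ‖z j‖ ^ m * (1 / 2)).trans (hre j)) (mem_univ i))
  have h3 := (Complex.re_le_norm _).trans (h m hNm)
  linarith

theorem iterate_pow_apply {M : Type*} [Monoid M] (q n : ℕ) (x : M) :
    (fun y : M => y ^ q)^[n] x = x ^ q ^ n := by
  rw [pow_iterate]

section
open Polynomial

/-- The product of `X - y` over the first `k` Frobenius conjugates `y` of `x`. -/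
noncomputable def frobNorm (F : Type*) [Fintype F] {L : Type*} [Field L] (k : ℕ) (x : L) : L[X] :=
  ∏ i ∈ range k, (X - C (x ^ Fintype.card F ^ i))

theorem frobNorm_monic {F : Type*} [Fintype F] {L : Type*} [Field L]
    (k : ℕ) (x : L) : (frobNorm F k x).Monic :=
  monic_prod_of_monic _ _ fun _ _ => monic_X_sub_C _

theorem frobNorm_natDegree {F : Type*} [Fintype F] {L : Type*} [Field L]
    (k : ℕ) (x : L) : (frobNorm F k x).natDegree = k := by
  rw [frobNorm, natDegree_prod_of_monic _ _ fun _ _ => monic_X_sub_C _]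
  simp [-map_pow]

theorem frobNorm_mul {F : Type*} [Fintype F] {L : Type*} [Field L]
    {d : ℕ} {x : L} (hx : x ^ Fintype.card F ^ d = x) (j : ℕ) :
    frobNorm F (d * j) x = frobNorm F d x ^ j := by
  induction j with
  | zero => simp [frobNorm]
  | succ j ih =>
    rw [pow_succ, ← ih, mul_add, mul_one, frobNorm, prod_range_add]
    congr 1
    refine prod_congr rfl fun i _ => ?_
    congr 2
    have hper : Function.IsPeriodicPt (fun y : L => y ^ Fintype.card F) d x := by
      rw [Function.IsPeriodicPt, Function.IsFixedPt, iterate_pow_apply, hx]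
    have := hper.mul_const j
    rw [Function.IsPeriodicPt, Function.IsFixedPt, iterate_pow_apply] at this
    rw [pow_add, pow_mul, this]

variable (F : Type*) [Field F] [Fintype F] (L : Type*) [Field L]

/-- The fixed points in `L` of the `n`-th power of the Frobenius of `F`. -/
noncomputable def frobFixed (n : ℕ) : Finset L :=
  open Classical in (X ^ Fintype.card F ^ n - X : L[X]).roots.toFinset

/-- The descent of `frobNorm F k x` to a polynomial over `F`, when it exists. -/
noncomputable def frobNormDescent {L : Type*} [Field L] [Algebra F L] (k : ℕ) (x : L) : F[X] :=
  Function.invFun (Polynomial.map (algebraMap F L)) (frobNorm F k x)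

/-- The monic polynomials of degree `n`. -/
noncomputable def monicsOfDegree (n : ℕ) : Finset F[X] :=
  Set.Finite.toFinset (s := {g : F[X] | g.Monic ∧ g.natDegree = n}) <| by
    have : Finite F := inferInstance
    refine Set.Finite.of_injOn (f := fun g (i : Fin n) => g.coeff i) (t := Set.univ)
      (fun _ _ => Set.mem_univ _) ?_ Set.finite_univ
    rintro g ⟨hg, hgn⟩ h ⟨hh, hhn⟩ hgh
    ext i
    rcases lt_trichotomy i n with hi | rfl | hi
    · exact congrFun hgh ⟨i, hi⟩
    · rw [← hgn, hg.coeff_natDegree, hgn, ← hhn, hh.coeff_natDegree]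
    · rw [coeff_eq_zero_of_natDegree_lt (by omega), coeff_eq_zero_of_natDegree_lt (by omega)]

variable {F L}

theorem mem_monicsOfDegree {n : ℕ} {g : F[X]} :
    g ∈ monicsOfDegree F n ↔ g.Monic ∧ g.natDegree = n := by
  simp [monicsOfDegree]

theorem mem_frobFixed {n : ℕ} (hn : n ≠ 0) {x : L} :
    x ∈ frobFixed F L n ↔ x ^ Fintype.card F ^ n = x := by
  classical
  rw [frobFixed, Multiset.mem_toFinset, mem_roots
    (FiniteField.X_pow_card_pow_sub_X_ne_zero _ hn Fintype.one_lt_card)]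
  simp [sub_eq_zero]

variable [Algebra F L]

theorem card_frobFixed [IsAlgClosed L] {n : ℕ} (hn : n ≠ 0) :
    (frobFixed F L n).card = Fintype.card F ^ n := by
  classical
  obtain ⟨p, _⟩ := CharP.exists F
  have : CharP L p := charP_of_injective_algebraMap (algebraMap F L).injective p
  have hsep : (X ^ Fintype.card F ^ n - X : L[X]).Separable := by
    refine galois_poly_separable p _ (dvd_pow ?_ hn)
    rw [← CharP.cast_eq_zero_iff F p]
    exact FiniteField.cast_card_eq_zero F
  rw [frobFixed, Multiset.toFinset_card_of_nodup (nodup_roots hsep),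
    ← (IsAlgClosed.splits _).natDegree_eq_card_roots,
    FiniteField.X_pow_card_pow_sub_X_natDegree_eq _ hn Fintype.one_lt_card]

theorem mem_range_algebraMap_of_pow_card_eq {c : L} (hc : c ^ Fintype.card F = c) :
    c ∈ Set.range (algebraMap F L) := by
  classical
  have hsub : univ.image (algebraMap F L) ⊆ frobFixed F L 1 := by
    intro y hy
    obtain ⟨a, -, rfl⟩ := mem_image.1 hy
    rw [mem_frobFixed one_ne_zero, pow_one, ← map_pow, FiniteField.pow_card]
  have hcard : (frobFixed F L 1).card ≤ (univ.image (algebraMap F L)).card := by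
    rw [card_image_of_injective _ (algebraMap F L).injective, card_univ, frobFixed]
    refine (Multiset.toFinset_card_le _).trans ((card_roots' _).trans ?_)
    rw [FiniteField.X_pow_card_pow_sub_X_natDegree_eq _ one_ne_zero Fintype.one_lt_card, pow_one]
  have hmem : c ∈ frobFixed F L 1 := by rwa [mem_frobFixed one_ne_zero, pow_one]
  rw [← eq_of_subset_of_card_le hsub hcard] at hmem
  obtain ⟨a, -, ha⟩ := mem_image.1 hmem
  exact ⟨a, ha⟩

theorem map_frobNormDescent {k : ℕ} {x : L} (hx : x ^ Fintype.card F ^ k = x) :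
    (frobNormDescent F k x).map (algebraMap F L) = frobNorm F k x := by
  refine Function.invFun_eq (f := Polynomial.map (algebraMap F L)) ?_
  have hmap : (frobNorm F k x).map (FiniteField.frobeniusAlgHom F L : L →+* L) =
      frobNorm F k x := by
    rcases k with _ | k
    · simp [frobNorm]
    · rw [frobNorm, Polynomial.map_prod, prod_range_succ, prod_range_succ', pow_zero, pow_one]
      congr 1
      · refine prod_congr rfl fun i _ => ?_
        simp [-map_pow, ← pow_mul, pow_succ]
      · simp [-map_pow, ← pow_mul, ← pow_succ, hx]
  have hl : frobNorm F k x ∈ lifts (algebraMap F L) := by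
    rw [lifts_iff_coeff_lifts]
    intro n
    apply mem_range_algebraMap_of_pow_card_eq
    conv_rhs => rw [← hmap]
    rw [coeff_map]
    simp
  exact (mem_lifts _).1 hl

theorem frobNormDescent_mem {k : ℕ} {x : L} (hx : x ^ Fintype.card F ^ k = x) :
    frobNormDescent F k x ∈ monicsOfDegree F k := by
  have h := map_frobNormDescent hx
  have h1 := frobNorm_monic (F := F) k x
  have h2 := frobNorm_natDegree (F := F) k x
  rw [← h] at h1 h2
  rw [mem_monicsOfDegree]
  exact ⟨monic_of_injective (algebraMap F L).injective h1, by rwa [natDegree_map] at h2⟩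

theorem rootPowerSum_frobNormDescent {k : ℕ} {x : L} (hx : x ^ Fintype.card F ^ k = x) {j : ℕ}
    (hj : j ≠ 0) : algebraMap F L (rootPowerSum (frobNormDescent F k x) j) =
      ∑ i ∈ range k, (x ^ Fintype.card F ^ i) ^ j := by
  rw [← rootPowerSum_map _ (mem_monicsOfDegree.1 (frobNormDescent_mem hx)).1,
    map_frobNormDescent hx, frobNorm, rootPowerSum_prod _ _ hj]

theorem X_sub_C_pow_dvd_map {g : F[X]} {x : L} {j : ℕ}
    (h : (X - C x) ^ j ∣ g.map (algebraMap F L)) (i : ℕ) :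
    (X - C (x ^ Fintype.card F ^ i)) ^ j ∣ g.map (algebraMap F L) := by
  have := Polynomial.map_dvd (FiniteField.frobeniusAlgHom F L ^ i : L →ₐ[F] L).toRingHom h
  rw [Polynomial.map_map] at this
  simpa [frobenius_pow_apply, AlgHom.comp_algebraMap] using this

theorem minimalPeriod_pos_of_root {g : F[X]} (hg : g ≠ 0) {x : L}
    (hx : x ∈ (g.map (algebraMap F L)).roots) :
    0 < Function.minimalPeriod (fun y : L => y ^ Fintype.card F) x := by
  classical
  have hg' : g.map (algebraMap F L) ≠ 0 :=
    (Polynomial.map_ne_zero_iff (algebraMap F L).injective).2 hg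
  have hroot (i : ℕ) : x ^ Fintype.card F ^ i ∈ (g.map (algebraMap F L)).roots.toFinset := by
    rw [Multiset.mem_toFinset, mem_roots hg', ← dvd_iff_isRoot]
    have h1 : (X - C x) ^ 1 ∣ g.map (algebraMap F L) := by
      rw [pow_one]
      exact dvd_iff_isRoot.2 (isRoot_of_mem_roots hx)
    have h2 := X_sub_C_pow_dvd_map h1 i
    rwa [pow_one] at h2
  obtain ⟨i, j, hij, h⟩ := Finite.exists_ne_map_eq_of_infinite
    fun i : ℕ => (⟨_, hroot i⟩ : {y // y ∈ (g.map (algebraMap F L)).roots.toFinset})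
  rw [Subtype.mk.injEq] at h
  wlog hlt : i < j generalizing i j
  · exact this j i hij.symm h.symm (by omega)
  apply Function.IsPeriodicPt.minimalPeriod_pos (n := j - i) (by omega)
  have hinj : Function.Injective (FiniteField.frobeniusAlgHom F L ^ i : L →ₐ[F] L) :=
    RingHom.injective (FiniteField.frobeniusAlgHom F L ^ i : L →ₐ[F] L).toRingHom
  apply hinj
  rw [iterate_pow_apply, frobenius_pow_apply, frobenius_pow_apply, ← pow_mul, ← pow_add,
    Nat.sub_add_cancel hlt.le, h]

theorem card_frobNorm_dvd {g : F[X]} (hg : g ≠ 0) {x : L}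
    (hx : x ∈ (g.map (algebraMap F L)).roots) :
    open Classical in
    ((Icc 1 g.natDegree).filter fun k => x ^ Fintype.card F ^ k = x ∧
      frobNorm F k x ∣ g.map (algebraMap F L)).card =
        (g.map (algebraMap F L)).rootMultiplicity x := by
  classical
  have hd := minimalPeriod_pos_of_root hg hx
  set d := Function.minimalPeriod (fun y : L => y ^ Fintype.card F) x with hd_def
  have hg' : g.map (algebraMap F L) ≠ 0 :=
    (Polynomial.map_ne_zero_iff (algebraMap F L).injective).2 hg
  have hfix (k : ℕ) : x ^ Fintype.card F ^ k = x ↔ d ∣ k := by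
    rw [hd_def, ← Function.isPeriodicPt_iff_minimalPeriod_dvd, Function.IsPeriodicPt,
      Function.IsFixedPt, iterate_pow_apply]
  have hxd := (hfix d).2 dvd_rfl
  have hcop : (range d : Set ℕ).Pairwise
      (Function.onFun IsCoprime fun i => (X - C (x ^ Fintype.card F ^ i) : L[X])) := by
    intro i hi j hj hij
    refine isCoprime_X_sub_C_of_isUnit_sub (IsUnit.mk0 _ (sub_ne_zero.2 fun h => hij ?_))
    refine (Function.iterate_injOn_Iio_minimalPeriod (f := fun y : L => y ^ Fintype.card F)
      (x := x)) (by simpa using hi) (by simpa using hj) ?_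
    simpa only [iterate_pow_apply] using h
  have hiff (j : ℕ) : frobNorm F (d * j) x ∣ g.map (algebraMap F L) ↔
      j ≤ (g.map (algebraMap F L)).rootMultiplicity x := by
    rw [le_rootMultiplicity_iff hg', frobNorm_mul hxd]
    constructor
    · intro h
      refine (pow_dvd_pow_of_dvd ?_ j).trans h
      have := dvd_prod_of_mem (fun i => (X - C (x ^ Fintype.card F ^ i) : L[X])) (mem_range.2 hd)
      simpa [-map_pow, frobNorm] using this
    · intro h
      rw [frobNorm, ← prod_pow]
      refine Finset.prod_dvd_of_coprime ?_ fun i _ => X_sub_C_pow_dvd_map h i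
      intro i hi j' hj hij
      exact (hcop hi hj hij).pow
  have : ((Icc 1 g.natDegree).filter fun k => x ^ Fintype.card F ^ k = x ∧
      frobNorm F k x ∣ g.map (algebraMap F L)) =
      (Icc 1 ((g.map (algebraMap F L)).rootMultiplicity x)).image (d * ·) := by
    ext k
    simp only [mem_filter, mem_Icc, mem_image, hfix]
    constructor
    · rintro ⟨⟨hk, -⟩, ⟨j, rfl⟩, hdvd⟩
      refine ⟨j, ⟨?_, (hiff j).1 hdvd⟩, rfl⟩
      exact Nat.pos_of_ne_zero fun h => by simp [h] at hk
    · rintro ⟨j, ⟨hj, hjm⟩, rfl⟩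
      have hdvd := (hiff j).2 hjm
      refine ⟨⟨Nat.mul_pos hd hj, ?_⟩, dvd_mul_right _ _, hdvd⟩
      have := natDegree_le_of_dvd hdvd hg'
      rwa [frobNorm_natDegree, natDegree_map] at this
  rw [this, card_image_of_injective _ fun a b h => Nat.eq_of_mul_eq_mul_left hd h, Nat.card_Icc,
    Nat.add_sub_cancel]

theorem sum_card_frobNormDescent_dvd [IsAlgClosed L] {n : ℕ} {g : F[X]}
    (hg : g ∈ monicsOfDegree F n) :
    open Classical in
    ∑ k ∈ Icc 1 n, ((frobFixed F L k).filter fun x => frobNormDescent F k x ∣ g).card = n := by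
  classical
  obtain ⟨hmon, rfl⟩ := mem_monicsOfDegree.1 hg
  have hg' : g.map (algebraMap F L) ≠ 0 :=
    (Polynomial.map_ne_zero_iff (algebraMap F L).injective).2 hmon.ne_zero
  set R := (g.map (algebraMap F L)).roots.toFinset with hR
  have h1 : ∀ k ∈ Icc 1 g.natDegree,
      ((frobFixed F L k).filter fun x => frobNormDescent F k x ∣ g) =
      R.filter fun x => x ^ Fintype.card F ^ k = x ∧
        frobNorm F k x ∣ g.map (algebraMap F L) := by
    intro k hk
    have hk0 : k ≠ 0 := by have := (mem_Icc.1 hk).1; omega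
    ext x
    rw [mem_filter, mem_filter, mem_frobFixed hk0]
    constructor
    · rintro ⟨hx, hdvd⟩
      rw [← map_dvd_map' (algebraMap F L), map_frobNormDescent hx] at hdvd
      refine ⟨?_, hx, hdvd⟩
      rw [hR, Multiset.mem_toFinset, mem_roots hg', ← dvd_iff_isRoot]
      refine dvd_trans ?_ hdvd
      have := dvd_prod_of_mem (fun i => (X - C (x ^ Fintype.card F ^ i) : L[X]))
        (mem_range.2 (Nat.pos_of_ne_zero hk0))
      simpa [-map_pow, frobNorm] using this
    · rintro ⟨-, hx, hdvd⟩
      rw [← map_frobNormDescent hx, map_dvd_map'] at hdvd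
      exact ⟨hx, hdvd⟩
  rw [sum_congr rfl fun k hk => congrArg card (h1 k hk)]
  simp only [card_filter]
  rw [sum_comm]
  simp only [← card_filter]
  rw [sum_congr rfl fun x hx => card_frobNorm_dvd hmon.ne_zero (Multiset.mem_toFinset.1 hx)]
  simp only [← count_roots]
  rw [Multiset.toFinset_sum_count_eq, ← (IsAlgClosed.splits _).natDegree_eq_card_roots,
    natDegree_map]

theorem sum_monicsOfDegree_filter_dvd {M : Type*} [AddCommMonoid M] {n k : ℕ} (hk : k ≤ n)
    {N : F[X]} (hN : N ∈ monicsOfDegree F k) (w : F[X] → M) :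
    open Classical in
    ∑ g ∈ (monicsOfDegree F n).filter (N ∣ ·), w g =
      ∑ h ∈ monicsOfDegree F (n - k), w (N * h) := by
  classical
  obtain ⟨hNm, hNd⟩ := mem_monicsOfDegree.1 hN
  symm
  refine sum_bij (fun h _ => N * h) ?_ ?_ ?_ fun _ _ => rfl
  · intro h hh
    obtain ⟨hm, hd⟩ := mem_monicsOfDegree.1 hh
    rw [mem_filter, mem_monicsOfDegree, hNm.natDegree_mul hm]
    exact ⟨⟨hNm.mul hm, by omega⟩, dvd_mul_right _ _⟩
  · intro h _ h' _ heq
    exact mul_left_cancel₀ hNm.ne_zero heq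
  · intro g hg
    rw [mem_filter, mem_monicsOfDegree] at hg
    obtain ⟨⟨hm, hd⟩, h, rfl⟩ := hg
    have hhm := hNm.of_mul_monic_left hm
    refine ⟨h, ?_, rfl⟩
    rw [hNm.natDegree_mul hhm] at hd
    exact mem_monicsOfDegree.2 ⟨hhm, by omega⟩

/-- The logarithmic derivative of the Euler product of a completely multiplicative weight `w` on
monic polynomials, compared coefficientwise. -/
theorem natCast_mul_sum_monicsOfDegree [IsAlgClosed L] (w : F[X] → ℂ)
    (hw : ∀ g h : F[X], g.Monic → h.Monic → w (g * h) = w g * w h) (n : ℕ) :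
    n * ∑ g ∈ monicsOfDegree F n, w g =
      ∑ k ∈ Icc 1 n, (∑ x ∈ frobFixed F L k, w (frobNormDescent F k x)) *
        ∑ h ∈ monicsOfDegree F (n - k), w h := by
  classical
  have h1 : ∀ g ∈ monicsOfDegree F n, n * w g =
      ∑ k ∈ Icc 1 n, ∑ x ∈ frobFixed F L k, if frobNormDescent F k x ∣ g then w g else 0 := by
    intro g hg
    conv_lhs => rw [← sum_card_frobNormDescent_dvd (L := L) hg]
    rw [Nat.cast_sum, sum_mul]
    refine sum_congr rfl fun k _ => ?_
    rw [← sum_filter, sum_const, nsmul_eq_mul]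
  rw [mul_sum, sum_congr rfl h1, sum_comm]
  refine sum_congr rfl fun k hk => ?_
  obtain ⟨hk1, hkn⟩ := mem_Icc.1 hk
  rw [sum_comm, sum_mul]
  refine sum_congr rfl fun x hx => ?_
  have hN := frobNormDescent_mem ((mem_frobFixed (by omega)).1 hx)
  rw [← sum_filter, sum_monicsOfDegree_filter_dvd hkn hN, mul_sum]
  exact sum_congr rfl fun h hh =>
    hw _ _ (mem_monicsOfDegree.1 hN).1 (mem_monicsOfDegree.1 hh).1
end

section
open Polynomial

/-- The weight `g ↦ ψ (a p_s(g) + b p_1(g))`, where `p_j` is the `j`-th power sum of the roots. -/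
noncomputable def powerSumWeight {F : Type*} [Field F] (ψ : AddChar F ℂ) (a b : F) (s : ℕ)
    (g : F[X]) : ℂ :=
  ψ (a * rootPowerSum g s + b * rootPowerSum g 1)

theorem powerSumWeight_mul {F : Type*} [Field F] (ψ : AddChar F ℂ) (a b : F) (s : ℕ) {g h : F[X]}
    (hg : g.Monic) (hh : h.Monic) :
    powerSumWeight ψ a b s (g * h) = powerSumWeight ψ a b s g * powerSumWeight ψ a b s h := by
  rw [powerSumWeight, powerSumWeight, powerSumWeight, ← AddChar.map_add_eq_mul,
    rootPowerSum_mul hg hh, rootPowerSum_mul hg hh]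
  congr 1
  ring

variable {F : Type*} [Field F] [Fintype F]

theorem sum_powerSumWeight_eq_zero {ψ : AddChar F ℂ} (hψ : ψ ≠ 1) {a : F} (ha : a ≠ 0) (b : F)
    {s : ℕ} (hs : 2 ≤ s) (hsF : (s : F) ≠ 0) {n : ℕ} (hn : s ≤ n) :
    ∑ g ∈ monicsOfDegree F n, powerSumWeight ψ a b s g = 0 := by
  obtain ⟨v, hv⟩ := AddChar.ne_one_iff.1 hψ
  set u : F := -v / (a * s) with hu
  have huv : -(a * (s * u)) = v := by rw [hu]; field_simp
  have hshift {g : F[X]} (hg : g ∈ monicsOfDegree F n) (u : F) :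
      g + C u * X ^ (n - s) ∈ monicsOfDegree F n := by
    obtain ⟨hm, rfl⟩ := mem_monicsOfDegree.1 hg
    have hlt : (C u * X ^ (g.natDegree - s)).natDegree < g.natDegree :=
      (natDegree_C_mul_X_pow_le _ _).trans_lt (by omega)
    exact mem_monicsOfDegree.2 ⟨hm.add_of_left (degree_lt_degree hlt),
      natDegree_add_eq_left_of_natDegree_lt hlt⟩
  have hsum : ∑ g ∈ monicsOfDegree F n, powerSumWeight ψ a b s g =
      ∑ g ∈ monicsOfDegree F n, ψ v * powerSumWeight ψ a b s g := by
    refine sum_bij' (fun g _ => g + C (-u) * X ^ (n - s)) (fun g _ => g + C u * X ^ (n - s))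
      (fun g hg => hshift hg _) (fun g hg => hshift hg _) (fun g _ => by simp) (fun g _ => by simp)
      fun g hg => ?_
    obtain ⟨hm, rfl⟩ := mem_monicsOfDegree.1 hg
    simp only [powerSumWeight]
    rw [← AddChar.map_add_eq_mul, rootPowerSum_add_X_pow hm _ (by omega) hn le_rfl,
      rootPowerSum_add_X_pow hm _ (by omega) hn (by omega), if_pos rfl, if_neg (by omega), ← huv]
    congr 1
    ring
  rw [← mul_sum] at hsum
  have h0 : (1 - ψ v) * ∑ g ∈ monicsOfDegree F n, powerSumWeight ψ a b s g = 0 := by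
    linear_combination hsum
  exact (mul_eq_zero.1 h0).resolve_left (sub_ne_zero.2 fun h => hv h.symm)

theorem sum_powerSumWeight_degree_one (ψ : AddChar F ℂ) (a b : F) {s : ℕ} (hs : s ≠ 0) :
    ∑ g ∈ monicsOfDegree F 1, powerSumWeight ψ a b s g = ∑ x : F, ψ (a * x ^ s + b * x) := by
  symm
  refine sum_bij (fun x _ => X - C x) ?_ ?_ ?_ ?_
  · intro x _
    exact mem_monicsOfDegree.2 ⟨monic_X_sub_C x, natDegree_X_sub_C x⟩
  · intro x _ y _ h
    simpa using h
  · intro g hg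
    obtain ⟨hm, hd⟩ := mem_monicsOfDegree.1 hg
    refine ⟨-g.coeff 0, mem_univ _, ?_⟩
    rw [hm.eq_X_add_C hd]
    simp
  · intro x _
    rw [powerSumWeight, rootPowerSum_X_sub_C x hs, rootPowerSum_X_sub_C x one_ne_zero, pow_one]

theorem sum_powerSumWeight_degree_zero (ψ : AddChar F ℂ) (a b : F) (s : ℕ) :
    ∑ g ∈ monicsOfDegree F 0, powerSumWeight ψ a b s g = 1 := by
  have h : monicsOfDegree F 0 = {1} := by
    ext g
    rw [mem_monicsOfDegree, mem_singleton]
    constructor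
    · rintro ⟨hm, hd⟩
      exact hm.natDegree_eq_zero.1 hd
    · rintro rfl
      simp
  have h1 : (1 : F[X]).reverse = 1 := by simpa using reverse_C (1 : F)
  simp [h, powerSumWeight, rootPowerSum, h1, negLogDeriv]

/-- An additive character sum is small when no fibre exceeds the average size by much. -/
theorem norm_sum_addChar_le {ι : Type*} {ψ : AddChar F ℂ} (hψ : ψ ≠ 1) (K : Finset ι) (t : ι → F)
    (B : ℝ) (hB : ∀ z, open Classical in ((K.filter fun x => t x = z).card : ℝ) ≤ B) :
    ‖∑ x ∈ K, ψ (t x)‖ ≤ Fintype.card F * B - K.card := by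
  classical
  have h1 : ∑ x ∈ K, ψ (t x) = ∑ z, ((K.filter fun x => t x = z).card - B : ℂ) * ψ z := by
    simp only [sub_mul, sum_sub_distrib, ← mul_sum]
    rw [AddChar.sum_eq_zero_of_ne_one hψ, mul_zero, sub_zero,
      ← sum_fiberwise_of_maps_to (fun x _ => mem_univ (t x))]
    refine sum_congr rfl fun z _ => ?_
    rw [sum_congr rfl (g := fun _ => ψ z) fun x hx => by rw [(mem_filter.1 hx).2]]
    simp
  have h2 : (K.card : ℝ) = ∑ z, ((K.filter fun x => t x = z).card : ℝ) := by
    rw [card_eq_sum_card_fiberwise fun x _ => mem_coe.2 (mem_univ (t x))]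
    simp
  rw [h1, h2]
  calc _ ≤ ∑ z, ‖((K.filter fun x => t x = z).card - B : ℂ) * ψ z‖ := norm_sum_le _ _
    _ = ∑ z, (B - (K.filter fun x => t x = z).card) := by
      refine sum_congr rfl fun z _ => ?_
      rw [norm_mul, AddChar.norm_apply, mul_one]
      have : ((K.filter fun x => t x = z).card - B : ℂ) =
        (((K.filter fun x => t x = z).card - B : ℝ) : ℂ) := by push_cast; rfl
      rw [this, Complex.norm_real, Real.norm_eq_abs, abs_sub_comm,
        abs_of_nonneg (sub_nonneg.2 (hB z))]
    _ = _ := by simp [sum_sub_distrib]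

variable {L : Type*} [Field L] [Algebra F L] [IsAlgClosed L]

theorem norm_sum_powerSumWeight_frobFixed_le {ψ : AddChar F ℂ} (hψ : ψ ≠ 1) {a : F} (ha : a ≠ 0)
    (b : F) {s : ℕ} (hs : 2 ≤ s) (hcop : Nat.Coprime s (Fintype.card F)) {m : ℕ} (hm : s < m) :
    ‖∑ x ∈ frobFixed F L (2 * m), powerSumWeight ψ a b s (frobNormDescent F (2 * m) x)‖ ≤
      (2 * s + 3) * Fintype.card F * (Fintype.card F : ℝ) ^ m := by
  classical
  obtain ⟨m, rfl⟩ : ∃ m', m = m' + 1 := ⟨m - 1, by omega⟩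
  set f : L[X] := C (algebraMap F L a) * X ^ s + C (algebraMap F L b) * X with hf
  have hfdeg : f.natDegree = s := by
    have ha' : algebraMap F L a ≠ 0 := by simpa using ha
    rw [hf, natDegree_add_eq_left_of_natDegree_lt, natDegree_C_mul_X_pow _ _ ha']
    rw [natDegree_C_mul_X_pow _ _ ha']
    exact (natDegree_C_mul_le _ _).trans_lt (by rw [natDegree_X]; omega)
  have htrace : ∀ x ∈ frobFixed F L (2 * (m + 1)),
      algebraMap F L (a * rootPowerSum (frobNormDescent F (2 * (m + 1)) x) s +
        b * rootPowerSum (frobNormDescent F (2 * (m + 1)) x) 1) =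
      ∑ i ∈ range (2 * (m + 1)), f.eval x ^ Fintype.card F ^ i := by
    intro x hx
    have hx' := (mem_frobFixed (by omega)).1 hx
    rw [map_add, map_mul, map_mul, rootPowerSum_frobNormDescent hx' (by omega),
      rootPowerSum_frobNormDescent hx' one_ne_zero, mul_sum, mul_sum, ← sum_add_distrib]
    refine sum_congr rfl fun i _ => ?_
    rw [← frobenius_pow_apply F i (f.eval x), hf]
    simp only [eval_add, eval_mul, eval_C, eval_pow, eval_X, map_add, map_mul, map_pow,
      AlgHom.commutes, frobenius_pow_apply, pow_one]
  have hpow : s + 2 ≤ Fintype.card F ^ (m + 1) := by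
    have := Nat.lt_pow_self (n := m + 1) (Fintype.one_lt_card (α := F))
    omega
  refine (norm_sum_addChar_le hψ _ _
    ((Fintype.card F ^ (2 * m + 1) + (2 * s + 3) * Fintype.card F ^ (m + 1) : ℕ) : ℝ) ?_).trans ?_
  · intro z
    have := card_le_of_trace_eq (F := F) f (by rwa [hfdeg]) m (by rwa [hfdeg]) (algebraMap F L z)
      ((frobFixed F L (2 * (m + 1))).filter fun x =>
        a * rootPowerSum (frobNormDescent F (2 * (m + 1)) x) s +
        b * rootPowerSum (frobNormDescent F (2 * (m + 1)) x) 1 = z)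
      (fun x hx => (mem_frobFixed (by omega)).1 (mem_filter.1 hx).1)
      (fun x hx => by rw [← htrace x (mem_filter.1 hx).1, (mem_filter.1 hx).2])
    rw [hfdeg] at this
    exact_mod_cast this
  · rw [card_frobFixed (by omega)]
    push_cast
    apply le_of_eq
    ring
end

section
open Polynomial

/-- A complex polynomial with constant coefficient `1` is a product of factors `1 - ω X`. -/
theorem exists_prod_one_sub {P : ℂ[X]} {n : ℕ} (hP : P.natDegree ≤ n) (h0 : P.coeff 0 = 1) :
    ∃ ω : Fin n → ℂ, P = ∏ i, (1 - C (ω i) * X) := by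
  set M := P.reflect n with hM
  have hcoeff : M.coeff n = 1 := by rw [hM, coeff_reflect, revAt_le le_rfl, Nat.sub_self, h0]
  have hdeg : M.natDegree = n := by
    refine le_antisymm ?_ (le_natDegree_of_ne_zero (by simp [hcoeff]))
    rw [hM]
    exact natDegree_reflect_le.trans (by simp [hP])
  have hmon : M.Monic := by rw [Monic, leadingCoeff, hdeg, hcoeff]
  have hsplit := IsAlgClosed.splits M
  have hcard : M.roots.toList.length = n := by
    rw [Multiset.length_toList, ← hsplit.natDegree_eq_card_roots, hdeg]
  refine ⟨fun i => M.roots.toList.get (i.cast hcard.symm), ?_⟩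
  have hprod : M = ∏ i : Fin n, (X - C (M.roots.toList.get (i.cast hcard.symm))) := by
    conv_lhs => rw [hsplit.eq_prod_roots_of_monic hmon, ← Multiset.coe_toList M.roots,
      Multiset.map_coe, Multiset.prod_coe]
    rw [← List.prod_ofFn]
    congr 1
    apply List.ext_get <;> simp [hcard]
  rw [← reverse_prod_X_sub_C, ← hprod, reverse, hdeg, hM, reflect_reflect]

/-- Weil's bound for the binomial exponential sums `∑ ψ (a x ^ s + b x)`. -/
theorem norm_sum_addChar_binomial_le {F : Type*} [Field F] [Fintype F] {ψ : AddChar F ℂ}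
    (hψ : ψ ≠ 1) {a : F} (ha : a ≠ 0) (b : F) {s : ℕ} (hs : 2 ≤ s) (hsF : (s : F) ≠ 0)
    (hcop : Nat.Coprime s (Fintype.card F)) :
    ‖∑ x : F, ψ (a * x ^ s + b * x)‖ ≤ (s - 1 : ℕ) * √(Fintype.card F) := by
  set c : ℕ → ℂ := fun n => ∑ g ∈ monicsOfDegree F n, powerSumWeight ψ a b s g with hc
  set S : ℕ → ℂ := fun k => ∑ x ∈ frobFixed F (AlgebraicClosure F) k,
    powerSumWeight ψ a b s (frobNormDescent F k x) with hS
  have hrec (n : ℕ) : n * c n = ∑ k ∈ Icc 1 n, S k * c (n - k) :=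
    natCast_mul_sum_monicsOfDegree _ (fun g h hg hh => powerSumWeight_mul ψ a b s hg hh) n
  have hc0 : c 0 = 1 := sum_powerSumWeight_degree_zero ψ a b s
  have hcs (n : ℕ) (hn : s ≤ n) : c n = 0 := sum_powerSumWeight_eq_zero hψ ha b hs hsF hn
  set P : ℂ[X] := ∑ n ∈ range s, monomial n (c n) with hP
  have hPcoeff (n : ℕ) : P.coeff n = c n := by
    simp only [hP, finsetSum_coeff, coeff_monomial]
    rw [sum_ite_eq' (range s) n c]
    split_ifs with h
    · rfl
    · exact (hcs n (by simpa using h)).symm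
  have hPdeg : P.natDegree ≤ s - 1 := by
    rw [natDegree_le_iff_coeff_eq_zero]
    intro n hn
    rw [hPcoeff, hcs n (by omega)]
  obtain ⟨ω, hω⟩ := exists_prod_one_sub hPdeg (by rw [hPcoeff, hc0])
  have hser : PowerSeries.mk (fun k => if k = 0 then 0 else -S k) =
      negLogDeriv (P : PowerSeries ℂ) := by
    rw [eq_negLogDeriv_iff (by simp [hPcoeff, hc0])]
    ext n
    rw [PowerSeries.coeff_mul, Finset.Nat.sum_antidiagonal_eq_sum_range_succ_mk, map_neg,
      ← neg_eq_iff_eq_neg, ← sum_neg_distrib]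
    trans n * c n
    · rw [hrec, range_eq_Ico, sum_eq_sum_Ico_succ_bot (by omega)]
      simp only [PowerSeries.coeff_mk, if_true, zero_mul, neg_zero, zero_add]
      refine sum_congr (by ext; simp) fun k hk => ?_
      have : k ≠ 0 := by have := (mem_Icc.1 hk).1; omega
      simp [this, hPcoeff]
    · rcases n with _ | n
      · simp
      · rw [PowerSeries.coeff_succ_X_mul, PowerSeries.coeff_derivative, Polynomial.coeff_coe,
          hPcoeff]
        push_cast
        ring
  have hSω (k : ℕ) (hk : k ≠ 0) : S k = -∑ i, ω i ^ k := by
    have h1 := congrArg (PowerSeries.coeff k) hser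
    rw [hω, coeff_negLogDeriv_prod _ _ hk, PowerSeries.coeff_mk, if_neg hk] at h1
    rw [← h1, neg_neg]
  have hq : (0 : ℝ) < Fintype.card F := by exact_mod_cast Fintype.card_pos
  have hωq (i : Fin (s - 1)) : ‖ω i‖ ≤ √(Fintype.card F) := by
    have h1 := norm_le_one_of_power_sums_bounded (fun i => ω i ^ 2 / (Fintype.card F : ℂ))
      ((2 * s + 3) * Fintype.card F) (s + 1) (by
        intro m hm
        have h2 := norm_sum_powerSumWeight_frobFixed_le (L := AlgebraicClosure F) hψ ha b hs hcop
          (m := m) (by omega)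
        change ‖S (2 * m)‖ ≤ _ at h2
        rw [hSω _ (by omega), norm_neg] at h2
        simp only [div_pow, ← pow_mul, ← sum_div]
        rw [norm_div, norm_pow, Complex.norm_natCast, div_le_iff₀ (by positivity)]
        exact h2) i
    rw [norm_div, norm_pow, Complex.norm_natCast, div_le_one hq] at h1
    exact Real.le_sqrt_of_sq_le h1
  have hc1 : c 1 = S 1 := by simpa [hc0] using hrec 1
  rw [← sum_powerSumWeight_degree_one ψ a b (by omega)]
  change ‖c 1‖ ≤ _
  rw [hc1, hSω 1 one_ne_zero, norm_neg]
  calc _ ≤ ∑ i, ‖ω i ^ 1‖ := norm_sum_le _ _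
    _ ≤ ∑ _i : Fin (s - 1), √(Fintype.card F) := by
      gcongr with i
      rw [pow_one]
      exact hωq i
    _ = _ := by simp
end

section
variable {M V ι : Type*} [Fintype M] [AddCommGroup V] [Finite V]

/-- Parseval's identity for a family of characters satisfying orthogonality. -/
theorem sum_norm_sq_sum_addChar [DecidableEq V] {e : M → AddChar V ℂ} {N : ℕ}
    (he : ∀ v, ∑ m, e m v = if v = 0 then (N : ℂ) else 0) (T : Finset ι) (σ : ι → V) :
    ∑ m, ‖∑ x ∈ T, e m (σ x)‖ ^ 2 =
      N * ((T ×ˢ T).filter fun p => σ p.1 = σ p.2).card := by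
  have h1 (m : M) : ((‖∑ x ∈ T, e m (σ x)‖ ^ 2 : ℝ) : ℂ) =
      ∑ p ∈ T ×ˢ T, e m (σ p.1 - σ p.2) := by
    push_cast
    rw [← Complex.mul_conj', map_sum, sum_mul_sum, ← sum_product']
    refine sum_congr rfl fun p _ => ?_
    rw [sub_eq_add_neg, AddChar.map_add_eq_mul, AddChar.map_neg_eq_conj]
  have h2 : ((∑ m, ‖∑ x ∈ T, e m (σ x)‖ ^ 2 : ℝ) : ℂ) =
      ((N * ((T ×ˢ T).filter fun p => σ p.1 = σ p.2).card : ℝ) : ℂ) := by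
    rw [Complex.ofReal_sum, sum_congr rfl fun m _ => h1 m, sum_comm]
    simp only [he, sub_eq_zero]
    rw [← sum_filter, sum_const, nsmul_eq_mul]
    push_cast
    ring
  exact_mod_cast h2

theorem norm_sum_product_le [DecidableEq V] [Fintype V] {e : M → AddChar V ℂ} {N : ℕ} (hN : N ≠ 0)
    (he : ∀ v, ∑ m, e m v = if v = 0 then (N : ℂ) else 0) (T : Finset ι) (σ : ι → V) (Φ : V → ℂ)
    (B : ℝ) (hΦ : ∀ m, ‖∑ y, Φ y * e m (-y)‖ ≤ B) :
    ‖∑ p ∈ T ×ˢ T, Φ (σ p.1 + σ p.2)‖ ≤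
      B * ((T ×ˢ T).filter fun p => σ p.1 = σ p.2).card := by
  have hinv (v : V) : N * Φ v = ∑ m, (∑ y, Φ y * e m (-y)) * e m v := by
    simp only [sum_mul]
    rw [sum_comm]
    have (y : V) : ∑ m, Φ y * e m (-y) * e m v = if v = y then N * Φ y else 0 := by
      rw [sum_congr rfl (g := fun m => Φ y * e m (v - y)) fun m _ => by
        rw [sub_eq_add_neg, AddChar.map_add_eq_mul]; ring, ← mul_sum, he]
      simp [sub_eq_zero, mul_comm]
    simp [this]
  have hsq : N * ∑ p ∈ T ×ˢ T, Φ (σ p.1 + σ p.2) =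
      ∑ m, (∑ y, Φ y * e m (-y)) * (∑ x ∈ T, e m (σ x)) ^ 2 := by
    rw [mul_sum, sum_congr rfl fun p _ => hinv _, sum_comm]
    refine sum_congr rfl fun m _ => ?_
    rw [← mul_sum, sq, sum_mul_sum T T, ← sum_product' T T]
    simp only [AddChar.map_add_eq_mul]
  have hN' : (0 : ℝ) < N := by positivity
  refine le_of_mul_le_mul_left ?_ hN'
  calc N * ‖∑ p ∈ T ×ˢ T, Φ (σ p.1 + σ p.2)‖
      = ‖N * ∑ p ∈ T ×ˢ T, Φ (σ p.1 + σ p.2)‖ := by rw [norm_mul, Complex.norm_natCast]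
    _ ≤ ∑ m, ‖(∑ y, Φ y * e m (-y)) * (∑ x ∈ T, e m (σ x)) ^ 2‖ := by
      rw [hsq]; exact norm_sum_le _ _
    _ ≤ ∑ m, B * ‖∑ x ∈ T, e m (σ x)‖ ^ 2 := by
      gcongr with m
      rw [norm_mul, norm_pow]
      gcongr
      exact hΦ m
    _ = _ := by rw [← mul_sum, sum_norm_sq_sum_addChar he]; ring
end

section
variable {F : Type*} [Field F] {d : ℕ}

/-- The character `v ↦ ψ (∑ j, m j * v j)` of `F ^ d`. -/
noncomputable def dotChar (ψ : AddChar F ℂ) (m : Fin d → F) : AddChar (Fin d → F) ℂ where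
  toFun v := ψ (∑ j, m j * v j)
  map_zero_eq_one' := by simp
  map_add_eq_mul' v w := by simp [mul_add, sum_add_distrib, AddChar.map_add_eq_mul]

theorem dotChar_apply (ψ : AddChar F ℂ) (m v : Fin d → F) :
    dotChar ψ m v = ψ (∑ j, m j * v j) := rfl

theorem addChar_sum_eq_prod (ψ : AddChar F ℂ) (f : Fin d → F) : ψ (∑ j, f j) = ∏ j, ψ (f j) :=
  map_prod ψ.toMonoidHom (fun j => Multiplicative.ofAdd (f j)) univ

variable [Fintype F]

theorem sum_dotChar [DecidableEq F] {ψ : AddChar F ℂ} (hψ : ψ.IsPrimitive) (v : Fin d → F) :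
    ∑ m, dotChar ψ m v = if v = 0 then ((Fintype.card F ^ d : ℕ) : ℂ) else 0 := by
  simp only [dotChar_apply, addChar_sum_eq_prod]
  rw [← Fintype.prod_sum (fun j t => ψ (t * v j))]
  simp only [AddChar.sum_mulShift _ hψ]
  split_ifs with h
  · simp [h]
  · obtain ⟨j, hj⟩ := Function.ne_iff.1 h
    exact prod_eq_zero (mem_univ j) (by simpa using hj)

theorem norm_sum_diagonal_le {ψ : AddChar F ℂ} (hψ : ψ ≠ 1) {a : Fin d → F} (ha : ∀ j, a j ≠ 0)
    (m : Fin d → F) {s : ℕ} (hs : 2 ≤ s) (hsF : (s : F) ≠ 0)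
    (hcop : Nat.Coprime s (Fintype.card F)) :
    ‖∑ y : Fin d → F, ψ (∑ j, a j * y j ^ s) * dotChar ψ m (-y)‖ ≤
      ((s - 1 : ℕ) * √(Fintype.card F)) ^ d := by
  have h1 (y : Fin d → F) : ψ (∑ j, a j * y j ^ s) * dotChar ψ m (-y) =
      ∏ j, ψ (a j * y j ^ s + -m j * y j) := by
    rw [dotChar_apply, ← AddChar.map_add_eq_mul, ← sum_add_distrib, addChar_sum_eq_prod]
    simp
  simp only [h1]
  rw [← Fintype.prod_sum (fun j t => ψ (a j * t ^ s + -m j * t)), norm_prod]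
  refine (prod_le_prod (fun _ _ => norm_nonneg _) fun j _ =>
    norm_sum_addChar_binomial_le hψ (ha j) (-m j) hs hsF hcop).trans ?_
  simp
end

theorem sum_card_fiber_sq {α ι : Type*} [Fintype α] [DecidableEq α] (U : Finset ι) (τ : ι → α) :
    ∑ t, (U.filter fun p => τ p = t).card ^ 2 =
      ((U ×ˢ U).filter fun p => τ p.1 = τ p.2).card := by
  rw [card_eq_sum_card_fiberwise (t := univ) (f := fun p : ι × ι => τ p.1) fun _ _ => by simp]
  refine sum_congr rfl fun t _ => ?_
  rw [sq, ← card_product]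
  congr 1
  ext ⟨x, y⟩
  simp only [mem_product, mem_filter]
  constructor
  · rintro ⟨⟨hx, rfl⟩, hy, h⟩
    exact ⟨⟨⟨hx, hy⟩, h.symm⟩, rfl⟩
  · rintro ⟨⟨⟨hx, hy⟩, h⟩, rfl⟩
    exact ⟨⟨hx, rfl⟩, hy, h.symm⟩

theorem energy_add_self {G : Type} [AddCommMonoid G] [DecidableEq G] (E : Finset G) (m : ℕ) :
    energy E (m + m) = (((Fintype.piFinset fun _ : Fin m => E) ×ˢ
      (Fintype.piFinset fun _ : Fin m => E)).filter
        fun p => ∑ i, p.1 i = ∑ i, p.2 i).card := by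
  rw [← card_map (Fin.appendEquiv m m).toEmbedding]
  refine Nat.subtype_card _ fun x => ?_
  obtain ⟨⟨y, z⟩, rfl⟩ := (Fin.appendEquiv m m).surjective x
  have h : (m + m) / 2 = m := by omega
  have h' (i : Fin m) : ¬ m ≤ (i : ℕ) := by omega
  simp [Fin.appendEquiv, sum_filter, Fin.sum_univ_add, Fin.forall_fin_add, h, h',
    -Fin.natAdd_eq_addNat, and_assoc]

theorem sum_piFinset_add {G M : Type*} [AddCommMonoid M] (E : Finset G) (m : ℕ)
    (f : (Fin (m + m) → G) → M) :
    ∑ x ∈ Fintype.piFinset fun _ : Fin (m + m) => E, f x =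
      ∑ p ∈ (Fintype.piFinset fun _ : Fin m => E) ×ˢ (Fintype.piFinset fun _ : Fin m => E),
        f (Fin.append p.1 p.2) := by
  symm
  refine sum_equiv (Fin.appendEquiv m m) (fun p => ?_) fun p _ => rfl
  simp [Fin.appendEquiv, Fin.forall_fin_add, -Fin.natAdd_eq_addNat]

theorem nuP_eq_card {F : Type} [Field F] [Fintype F] [DecidableEq F] {d : ℕ} (a : Fin d → F)
    (s : ℕ) (E : Finset (Fin d → F)) (X : Finset F) (k : ℕ) (t : F) :
    nuP a s E X k t = ((X ×ˢ Fintype.piFinset fun _ : Fin k => E).filter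
      fun p => p.1 + ∑ j, a j * ((∑ i, p.2 i) j) ^ s = t).card :=
  Nat.subtype_card _ fun p => by simp [and_assoc]

/-- Second-moment estimate for `ν_{P,k}` (even `k`). -/
theorem stmt14 (d s : ℕ) (hd : 1 ≤ d) (hs : 2 ≤ s) :
    ∃ C : ℝ, 0 < C ∧
      ∀ (F : Type) [Field F] [Fintype F],
        Odd (Fintype.card F) → ¬ (ringChar F ∣ s) →
        ∀ a : Fin d → F, (∀ j, a j ≠ 0) →
        ∀ E : Finset (Fin d → F), ∀ X : Finset F, ∀ k : ℕ, 2 ≤ k → Even k →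
        ∑ t : F, (nuP a s E X k t : ℝ) ^ 2 ≤
          (X.card : ℝ) ^ 2 * (E.card : ℝ) ^ (2 * k) / (Fintype.card F : ℝ) +
            C * (Fintype.card F : ℝ) ^ d * (X.card : ℝ) * (energy E k : ℝ) ^ 2 := by
  have hs1 : 0 < s - 1 := by omega
  refine ⟨((s - 1 : ℕ) : ℝ) ^ (2 * d), by positivity, ?_⟩
  intro F _ _ _ hchar a ha E X k _ hk
  classical
  obtain ⟨m, rfl⟩ := hk
  have hsF : (s : F) ≠ 0 := fun h => hchar ((ringChar.spec F s).1 h)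
  have hcop : Nat.Coprime s (Fintype.card F) := by
    obtain ⟨n, hp, hn⟩ := FiniteField.card F (ringChar F)
    rw [hn]
    exact Nat.Coprime.pow_right _ ((Nat.Prime.coprime_iff_not_dvd hp).2 hchar).symm
  set ψ := AddChar.FiniteField.primitiveChar_to_Complex F
  have hψ : ψ.IsPrimitive := AddChar.FiniteField.primitiveChar_to_Complex_isPrimitive F
  have hψ1 : ψ ≠ 1 := by simpa [AddChar.mulShift_one] using hψ one_ne_zero
  have hq : (0 : ℝ) < Fintype.card F := by exact_mod_cast Fintype.card_pos
  have horth (v : F) : ∑ h, ψ.mulShift h v = if v = 0 then (Fintype.card F : ℂ) else 0 := by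
    simp only [AddChar.mulShift_apply]
    rw [AddChar.sum_mulShift v hψ]
    simp
  set T := Fintype.piFinset fun _ : Fin (m + m) => E with hT
  set S : F → ℂ := fun h => ∑ x ∈ T, ψ (h * ∑ j, a j * ((∑ i, x i) j) ^ s) with hS
  set Xhat : F → ℂ := fun h => ∑ b ∈ X, ψ.mulShift h b with hXhat
  have hfactor (h : F) : ∑ p ∈ X ×ˢ T, ψ.mulShift h (p.1 + ∑ j, a j * ((∑ i, p.2 i) j) ^ s) =
      Xhat h * S h := by
    rw [hXhat, hS, sum_mul_sum, ← sum_product']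
    simp only [AddChar.map_add_eq_mul, AddChar.mulShift_apply]
  have hmoment : Fintype.card F * ∑ t : F, (nuP a s E X (m + m) t : ℝ) ^ 2 =
      ∑ h, ‖Xhat h‖ ^ 2 * ‖S h‖ ^ 2 := by
    let τ (p : F × (Fin (m + m) → Fin d → F)) : F := p.1 + ∑ j, a j * ((∑ i, p.2 i) j) ^ s
    have h1 := sum_norm_sq_sum_addChar horth (X ×ˢ T) τ
    rw [← sum_card_fiber_sq (X ×ˢ T) τ] at h1
    simp only [τ, hfactor, norm_mul, mul_pow] at h1
    rw [h1]
    simp only [nuP_eq_card]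
    push_cast
    rfl
  have hXsum : ∑ h, ‖Xhat h‖ ^ 2 = Fintype.card F * X.card := by
    refine (sum_norm_sq_sum_addChar horth X id).trans ?_
    rw [← diag_card X, diag_eq_filter]
    simp only [id]
  have hSbound (h : F) (hh : h ≠ 0) :
      ‖S h‖ ≤ ((s - 1 : ℕ) * √(Fintype.card F)) ^ d * energy E (m + m) := by
    have h1 := norm_sum_product_le (pow_ne_zero d Fintype.card_ne_zero)
      (sum_dotChar (d := d) hψ) (Fintype.piFinset fun _ : Fin m => E) (fun x => ∑ i, x i)
      (fun y => ψ (∑ j, h * a j * y j ^ s)) _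
      fun n => norm_sum_diagonal_le hψ1 (fun j => mul_ne_zero hh (ha j)) n hs hsF hcop
    rw [energy_add_self]
    convert h1 using 2
    rw [hS]
    simp only [hT]
    rw [sum_piFinset_add]
    simp [Fin.sum_univ_add, mul_sum, mul_assoc, -Fin.natAdd_eq_addNat]
  have hX0 : Xhat 0 = X.card := by simp [hXhat]
  have hS0 : S 0 = (E.card : ℂ) ^ (m + m) := by simp [hS, hT]
  have htail : ∑ h ∈ univ.erase 0, ‖Xhat h‖ ^ 2 * ‖S h‖ ^ 2 ≤
      Fintype.card F * X.card *
        (((s - 1 : ℕ) * √(Fintype.card F)) ^ d * energy E (m + m)) ^ 2 := by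
    rw [← hXsum, sum_mul]
    calc _ ≤ ∑ h ∈ univ.erase 0, ‖Xhat h‖ ^ 2 *
          (((s - 1 : ℕ) * √(Fintype.card F)) ^ d * energy E (m + m)) ^ 2 := by
          gcongr with h hh
          exact hSbound h (ne_of_mem_erase hh)
      _ ≤ _ := sum_le_sum_of_subset_of_nonneg (erase_subset _ _) fun _ _ _ => by positivity
  have hsqrt : √(Fintype.card F : ℝ) ^ 2 = Fintype.card F := Real.sq_sqrt hq.le
  refine le_of_mul_le_mul_left ?_ hq
  rw [hmoment, ← add_sum_erase _ _ (mem_univ 0), hX0, hS0]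
  refine (add_le_add_right htail _).trans (le_of_eq ?_)
  rw [mul_add, mul_div_cancel₀ _ hq.ne', norm_pow, Complex.norm_natCast, Complex.norm_natCast]
  congr 1
  · ring
  · rw [mul_pow, mul_pow, mul_pow, ← pow_mul (√_), mul_comm d 2, pow_mul (√_), hsqrt]
    ring
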